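/- Let A₁, A₂ be binary forms of order 5 over ℂ, and set C₀ = (A₁,A₂)_1 (a binary form of order 8) and C₂ = (−3/14)·(A₁,A₂)_3 (a binary form of order 4). Then C₀ · (A₁,A₂)_5 = 50·C₂² − 15·(C₀,C₀)_4 − 40·(C₀,C₂)_2. -/

import Mathlib

open MvPolynomial Finset

/-- The `k`-th transvectant of binary forms `E, F` of orders `e, f`. -/
noncomputable def transvectant (e f k : ℕ) (E F : MvPolynomial (Fin 2) ℂ) :
    MvPolynomial (Fin 2) ℂ :=
  ((((e - k).factorial * (f - k).factorial : ℕ) : ℂ) /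
      ((e.factorial * f.factorial : ℕ) : ℂ)) •
    ∑ i ∈ Finset.range (k + 1),
      ((-1 : ℂ) ^ i * (k.choose i : ℂ)) •
        ((⇑(pderiv (0 : Fin 2)))^[k - i] ((⇑(pderiv (1 : Fin 2)))^[i] E) *
          (⇑(pderiv (0 : Fin 2)))^[i] ((⇑(pderiv (1 : Fin 2)))^[k - i] F))

/-- The Wronskian of `s` binary forms of order `n`. -/
noncomputable def wronskian (n : ℕ) {s : ℕ} (F : Fin s → MvPolynomial (Fin 2) ℂ) :
    MvPolynomial (Fin 2) ℂ :=
  (((n - s + 1).factorial : ℂ) / (n.factorial : ℂ)) ^ s •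
    Matrix.det (Matrix.of fun i j : Fin s =>
      (⇑(pderiv (0 : Fin 2)))^[s - 1 - (j : ℕ)] ((⇑(pderiv (1 : Fin 2)))^[(j : ℕ)] (F i)))

/-- Remove the `i`-th member from a family indexed by `Fin r`. -/
def removeIdx {α : Sort*} {r : ℕ} (A : Fin r → α) (i : Fin r) : Fin (r - 1) → α :=
  fun j => A (Fin.cast (Nat.succ_pred_eq_of_pos i.pos)
    (Fin.succAbove (Fin.cast (Nat.succ_pred_eq_of_pos i.pos).symm i) j))

/-- `Γ_p(B; A₁,…,A_r) = Σᵢ (−1)^{i+1} (B,Aᵢ)_p · W(A₁,…,Âᵢ,…,A_r)`,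
where `B` has order `n` and the `Aᵢ` have order `d`. -/
noncomputable def gammaTransvectant (d n p : ℕ) {r : ℕ}
    (B : MvPolynomial (Fin 2) ℂ) (A : Fin r → MvPolynomial (Fin 2) ℂ) :
    MvPolynomial (Fin 2) ℂ :=
  ∑ i : Fin r, (-1 : ℂ) ^ (i : ℕ) •
    (transvectant n d p B (A i) * wronskian d (removeIdx A i))

/-- The index set `𝒩_r = {q : 0 ≤ q ≤ r, q ≠ 1}`. -/
def Nset (r : ℕ) : Finset ℕ := (Finset.range (r + 1)).filter (· ≠ 1)

/-- A Wronskian-combinant collection for binary forms `A₁,…,A_r` of order `d`: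
forms `C_q` of order `r(d−r+1)−2q` for `q ∈ 𝒩_r` with
`W(A₁,…,A_r,F) = Σ_q (C_q,F)_{r−q}` for all forms `F` of order `d`. -/
def IsWronskianCombinantCollection (d r : ℕ)
    (A : Fin r → MvPolynomial (Fin 2) ℂ) (C : ℕ → MvPolynomial (Fin 2) ℂ) : Prop :=
  (∀ q ∈ Nset r, (C q).IsHomogeneous (r * (d - r + 1) - 2 * q)) ∧
  ∀ F : MvPolynomial (Fin 2) ℂ, F.IsHomogeneous d →
    wronskian d (Fin.snoc A F) =
      ∑ q ∈ Nset r, transvectant (r * (d - r + 1) - 2 * q) d (r - q) (C q) F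


/-- The binary form of order `n` with binomially normalized coefficients `c`. -/
noncomputable def binaryForm (n : ℕ) (c : ℕ → ℂ) : MvPolynomial (Fin 2) ℂ :=
  ∑ i ∈ Finset.range (n + 1), C ((n.choose i : ℂ) * c i) * (X 0 ^ (n - i) * X 1 ^ i)

lemma binaryForm_add (n : ℕ) (c d : ℕ → ℂ) :
    binaryForm n (c + d) = binaryForm n c + binaryForm n d := by
  simp only [binaryForm, ← Finset.sum_add_distrib, Pi.add_apply, mul_add, map_add, add_mul]

lemma exists_binaryForm_eq_monomial (n : ℕ) (d : Fin 2 →₀ ℕ) (hd : d 0 + d 1 = n) (r : ℂ) :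
    ∃ c, monomial d r = binaryForm n c := by
  have hle : d 1 ≤ n := by lia
  have hne : (n.choose (d 1) : ℂ) ≠ 0 := by
    exact_mod_cast (Nat.choose_pos hle).ne'
  refine ⟨Pi.single (d 1) (r / n.choose (d 1)), ?_⟩
  rw [binaryForm, Finset.sum_eq_single (d 1)]
  · rw [Pi.single_eq_same, mul_div_cancel₀ _ hne, monomial_eq, Finsupp.prod_fintype _ _ (by simp),
      Fin.prod_univ_two, show n - d 1 = d 0 by lia]
  · intro i _ hi
    simp [Pi.single_eq_of_ne hi]
  · intro h
    exact absurd (Finset.mem_range.2 (by lia)) h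

lemma MvPolynomial.IsHomogeneous.exists_eq_binaryForm {n : ℕ} {F : MvPolynomial (Fin 2) ℂ}
    (hF : F.IsHomogeneous n) : ∃ c, F = binaryForm n c := by
  rw [F.as_sum]
  refine Finset.sum_induction _ (fun G => ∃ c, G = binaryForm n c) ?_ ?_ ?_
  · rintro _ _ ⟨c, rfl⟩ ⟨d, rfl⟩
    exact ⟨c + d, (binaryForm_add n c d).symm⟩
  · exact ⟨0, by simp [binaryForm]⟩
  · intro d hd
    refine exists_binaryForm_eq_monomial n d ?_ _
    have h := hF (mem_support_iff.1 hd)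
    simpa [Finsupp.weight_apply, Finsupp.sum_fintype] using h

lemma pderiv_zero_binaryForm (n : ℕ) (c : ℕ → ℂ) :
    pderiv 0 (binaryForm (n + 1) c) = ((n + 1 : ℕ) : ℂ) • binaryForm n c := by
  rw [binaryForm, Finset.sum_range_succ, map_add, map_sum, binaryForm, Finset.smul_sum]
  have hlast : pderiv (0 : Fin 2) (C (((n + 1).choose (n + 1) : ℂ) * c (n + 1)) *
      (X 0 ^ (n + 1 - (n + 1)) * X 1 ^ (n + 1)) : MvPolynomial (Fin 2) ℂ) = 0 := by
    simp
  rw [hlast, add_zero]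
  refine Finset.sum_congr rfl fun i hi => ?_
  obtain ⟨j, rfl⟩ : ∃ j, n = i + j := Nat.exists_eq_add_of_le (by simpa [Nat.lt_succ_iff] using hi)
  have h := Nat.add_one_mul_choose_eq (i + j) j
  rw [Nat.choose_symm_of_eq_add (show i + j = j + i by lia),
    Nat.choose_symm_of_eq_add (show i + j + 1 = (j + 1) + i by lia)] at h
  have h' : (((i + j + 1 : ℕ) : ℂ)) * ((i + j).choose i : ℂ) =
      ((i + j + 1).choose i : ℂ) * ((j + 1 : ℕ) : ℂ) := by exact_mod_cast h
  have h'' := congrArg (C (σ := Fin 2)) h'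
  simp only [map_mul, map_natCast] at h''
  rw [show i + j + 1 - i = j + 1 by lia, show i + j - i = j by lia, smul_eq_C_mul]
  simp only [Derivation.leibniz, Derivation.map_natCast, pderiv_C, Derivation.leibniz_pow,
    pderiv_X_self, pderiv_X_of_ne (show (1 : Fin 2) ≠ 0 by decide), smul_eq_mul, nsmul_eq_mul, map_mul,
    map_natCast, Nat.add_sub_cancel]
  linear_combination (-(C (c i) * (X 0 ^ j * X 1 ^ i)) : MvPolynomial (Fin 2) ℂ) * h''

lemma pderiv_one_binaryForm (n : ℕ) (c : ℕ → ℂ) :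
    pderiv 1 (binaryForm (n + 1) c) =
      ((n + 1 : ℕ) : ℂ) • binaryForm n (fun i => c (i + 1)) := by
  rw [binaryForm, Finset.sum_range_succ', map_add, map_sum, binaryForm, Finset.smul_sum]
  have hfirst : pderiv (1 : Fin 2) (C (((n + 1).choose 0 : ℂ) * c 0) *
      (X 0 ^ (n + 1 - 0) * X 1 ^ 0) : MvPolynomial (Fin 2) ℂ) = 0 := by
    simp
  rw [hfirst, add_zero]
  refine Finset.sum_congr rfl fun i _ => ?_
  have h' : (((n + 1 : ℕ) : ℂ)) * (n.choose i : ℂ) =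
      ((n + 1).choose (i + 1) : ℂ) * ((i + 1 : ℕ) : ℂ) := by
    exact_mod_cast Nat.add_one_mul_choose_eq n i
  have h'' := congrArg (C (σ := Fin 2)) h'
  simp only [map_mul, map_natCast] at h''
  rw [show n + 1 - (i + 1) = n - i by lia, smul_eq_C_mul]
  simp only [Derivation.leibniz, Derivation.map_natCast, pderiv_C, Derivation.leibniz_pow,
    pderiv_X_self, pderiv_X_of_ne (show (0 : Fin 2) ≠ 1 by decide), smul_eq_mul, nsmul_eq_mul, map_mul,
    map_natCast, Nat.add_sub_cancel]
  linear_combination (-(C (c (i + 1)) * (X 0 ^ (n - i) * X 1 ^ i)) : MvPolynomial (Fin 2) ℂ) * h''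

lemma iterate_pderiv_zero_binaryForm (n k : ℕ) (c : ℕ → ℂ) :
    (⇑(pderiv (0 : Fin 2)))^[k] (binaryForm (n + k) c) =
      ((n + k).descFactorial k : ℂ) • binaryForm n c := by
  induction k generalizing n with
  | zero => simp
  | succ k ih =>
    rw [Function.iterate_succ_apply', show n + (k + 1) = n + 1 + k by lia, ih, Derivation.map_smul,
      pderiv_zero_binaryForm, smul_smul, Nat.descFactorial_succ, Nat.add_sub_cancel, mul_comm,
      Nat.cast_mul]

lemma iterate_pderiv_one_binaryForm (n k : ℕ) (c : ℕ → ℂ) :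
    (⇑(pderiv (1 : Fin 2)))^[k] (binaryForm (n + k) c) =
      ((n + k).descFactorial k : ℂ) • binaryForm n (fun i => c (i + k)) := by
  induction k generalizing n with
  | zero => simp
  | succ k ih =>
    rw [Function.iterate_succ_apply', show n + (k + 1) = n + 1 + k by lia, ih, Derivation.map_smul,
      pderiv_one_binaryForm, smul_smul, Nat.descFactorial_succ, Nat.add_sub_cancel, mul_comm,
      Nat.cast_mul]
    simp only [add_assoc, add_comm 1 k]

lemma iterate_pderiv_smul (i : Fin 2) (k : ℕ) (r : ℂ) (F : MvPolynomial (Fin 2) ℂ) :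
    (⇑(pderiv i))^[k] (r • F) = r • (⇑(pderiv i))^[k] F := by
  induction k with
  | zero => rfl
  | succ k ih => simp only [Function.iterate_succ_apply', ih, Derivation.map_smul]

lemma iterate_pderiv_binaryForm (n k l : ℕ) (c : ℕ → ℂ) :
    (⇑(pderiv (0 : Fin 2)))^[k] ((⇑(pderiv (1 : Fin 2)))^[l] (binaryForm (n + (k + l)) c)) =
      ((n + (k + l)).descFactorial (k + l) : ℂ) • binaryForm n (fun i => c (i + l)) := by
  rw [← add_assoc, iterate_pderiv_one_binaryForm, iterate_pderiv_smul,
    iterate_pderiv_zero_binaryForm, smul_smul, ← Nat.cast_mul, add_comm k l,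
    ← Nat.descFactorial_mul_descFactorial (Nat.le_add_right l k)]
  simp only [Nat.add_sub_cancel, Nat.add_sub_cancel_left, mul_comm]

/-- Transvectants of binary forms, in terms of their normalized coefficients. -/
lemma transvectant_binaryForm (m n k : ℕ) (a b : ℕ → ℂ) :
    transvectant (m + k) (n + k) k (binaryForm (m + k) a) (binaryForm (n + k) b) =
      ∑ i ∈ Finset.range (k + 1), ((-1 : ℂ) ^ i * (k.choose i : ℂ)) •
        (binaryForm m (fun j => a (j + i)) * binaryForm n (fun j => b (j + (k - i)))) := by
  have hfac (m : ℕ) : ((m.factorial : ℕ) : ℂ) * ((m + k).descFactorial k : ℂ) =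
      ((m + k).factorial : ℂ) := by
    have h := Nat.factorial_mul_descFactorial (Nat.le_add_left k m)
    rw [Nat.add_sub_cancel] at h
    exact_mod_cast h
  have hm : ((m + k).factorial : ℂ) ≠ 0 := Nat.cast_ne_zero.2 (Nat.factorial_ne_zero _)
  have hn : ((n + k).factorial : ℂ) ≠ 0 := Nat.cast_ne_zero.2 (Nat.factorial_ne_zero _)
  rw [transvectant, Finset.smul_sum]
  refine Finset.sum_congr rfl fun i hi => ?_
  have hik : i ≤ k := Nat.lt_succ_iff.1 (Finset.mem_range.1 hi)
  have h₁ := iterate_pderiv_binaryForm m (k - i) i a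
  have h₂ := iterate_pderiv_binaryForm n i (k - i) b
  rw [Nat.sub_add_cancel hik] at h₁
  rw [Nat.add_sub_cancel' hik] at h₂
  rw [h₁, h₂, smul_mul_smul_comm, smul_smul, smul_smul, Nat.add_sub_cancel, Nat.add_sub_cancel]
  congr 1
  have hm' : (m.factorial : ℂ) ≠ 0 := left_ne_zero_of_mul (hfac m ▸ hm)
  have hn' : (n.factorial : ℂ) ≠ 0 := left_ne_zero_of_mul (hfac n ▸ hn)
  push_cast
  rw [← hfac m] at hm ⊢
  rw [← hfac n] at hn ⊢
  have hm'' := right_ne_zero_of_mul hm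
  have hn'' := right_ne_zero_of_mul hn
  field_simp

lemma binaryForm_congr {n : ℕ} {c d : ℕ → ℂ} (h : ∀ i ≤ n, c i = d i) :
    binaryForm n c = binaryForm n d :=
  Finset.sum_congr rfl fun i hi => by rw [h i (Nat.lt_succ_iff.1 (Finset.mem_range.1 hi))]

lemma binaryForm_smul (n : ℕ) (r : ℂ) (c : ℕ → ℂ) :
    binaryForm n (r • c) = r • binaryForm n c := by
  simp only [binaryForm, Finset.smul_sum, smul_eq_C_mul, Pi.smul_apply, smul_eq_mul, map_mul]
  exact Finset.sum_congr rfl fun i _ => by ring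

lemma binaryForm_sum {ι : Type*} (s : Finset ι) (n : ℕ) (c : ι → ℕ → ℂ) :
    binaryForm n (∑ i ∈ s, c i) = ∑ i ∈ s, binaryForm n (c i) := by
  simp only [binaryForm, Finset.sum_apply, Finset.mul_sum, map_sum, Finset.sum_mul]
  exact Finset.sum_comm

/-- The normalized coefficients of the product of two binary forms of orders `m` and `n` with
normalized coefficients `a` and `b`. -/
noncomputable def mulCoeff (m n : ℕ) (a b : ℕ → ℂ) (r : ℕ) : ℂ :=
  (∑ j ∈ Finset.range (r + 1), ((m.choose j : ℂ) * a j) * ((n.choose (r - j) : ℂ) * b (r - j))) /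
    ((m + n).choose r : ℂ)

lemma binaryForm_mul (m n : ℕ) (a b : ℕ → ℂ) :
    binaryForm m a * binaryForm n b = binaryForm (m + n) (mulCoeff m n a b) := by
  rw [binaryForm, binaryForm, Finset.sum_mul_sum, ← Finset.sum_product',
    ← Finset.sum_fiberwise_of_maps_to (t := Finset.range (m + n + 1)) (g := fun p => p.1 + p.2)
      (fun p hp => by simp only [Finset.mem_product, Finset.mem_range] at hp ⊢; lia), binaryForm]
  refine Finset.sum_congr rfl fun r hr => ?_
  have hr' : ((m + n).choose r : ℂ) ≠ 0 :=
    Nat.cast_ne_zero.2 (Nat.choose_pos (Nat.lt_succ_iff.1 (Finset.mem_range.1 hr))).ne'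
  rw [mulCoeff, mul_div_cancel₀ _ hr', map_sum, Finset.sum_mul,
    ← Finset.Nat.sum_antidiagonal_eq_sum_range_succ (fun i j =>
      C (((m.choose i : ℂ) * a i) * ((n.choose j : ℂ) * b j)) *
        (X 0 ^ (m + n - r) * X 1 ^ r : MvPolynomial (Fin 2) ℂ))]
  refine Finset.sum_subset_zero_on_sdiff ?_ ?_ ?_
  · intro p hp
    simpa using (Finset.mem_filter.1 hp).2
  · rintro ⟨i, j⟩ hp
    simp only [Finset.mem_sdiff, Finset.HasAntidiagonal.mem_antidiagonal, Finset.mem_filter,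
      Finset.mem_product, Finset.mem_range] at hp
    obtain hi | hj : m < i ∨ n < j := by lia
    · simp [Nat.choose_eq_zero_of_lt hi]
    · simp [Nat.choose_eq_zero_of_lt hj]
  · rintro ⟨i, j⟩ hp
    simp only [Finset.mem_filter, Finset.mem_product, Finset.mem_range] at hp
    obtain ⟨⟨hi, hj⟩, rfl⟩ := hp
    rw [show m + n - (i + j) = (m - i) + (n - j) by lia, pow_add, pow_add]
    simp only [map_mul]
    ring

/-- The normalized coefficients of the `k`-th transvectant of two binary forms of orders `m + k`
and `n + k` with normalized coefficients `a` and `b`. -/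
noncomputable def transvectantCoeff (m n k : ℕ) (a b : ℕ → ℂ) : ℕ → ℂ :=
  ∑ i ∈ Finset.range (k + 1), ((-1 : ℂ) ^ i * (k.choose i : ℂ)) •
    mulCoeff m n (fun j => a (j + i)) (fun j => b (j + (k - i)))

lemma transvectant_binaryForm_eq_binaryForm (m n k : ℕ) (a b : ℕ → ℂ) :
    transvectant (m + k) (n + k) k (binaryForm (m + k) a) (binaryForm (n + k) b) =
      binaryForm (m + n) (transvectantCoeff m n k a b) := by
  simp only [transvectant_binaryForm, transvectantCoeff, binaryForm_sum, binaryForm_smul,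
    binaryForm_mul]

/-- The normalized coefficients of the transvectant of index 1 of two binary quintics. -/
lemma transvectantCoeff_quintic_one (a b : ℕ → ℂ) :
    transvectantCoeff 4 4 1 a b 0 = a 0 * b 1 - a 1 * b 0 ∧
    transvectantCoeff 4 4 1 a b 1 = 1 / 2 * (a 0 * b 2 - a 2 * b 0) ∧
    transvectantCoeff 4 4 1 a b 2 =
      3 / 14 * (a 0 * b 3 - a 3 * b 0) + 5 / 14 * (a 1 * b 2 - a 2 * b 1) ∧
    transvectantCoeff 4 4 1 a b 3 =
      1 / 14 * (a 0 * b 4 - a 4 * b 0) + 5 / 14 * (a 1 * b 3 - a 3 * b 1) ∧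
    transvectantCoeff 4 4 1 a b 4 =
      1 / 70 * (a 0 * b 5 - a 5 * b 0) + 3 / 14 * (a 1 * b 4 - a 4 * b 1) +
        2 / 7 * (a 2 * b 3 - a 3 * b 2) ∧
    transvectantCoeff 4 4 1 a b 5 =
      1 / 14 * (a 1 * b 5 - a 5 * b 1) + 5 / 14 * (a 2 * b 4 - a 4 * b 2) ∧
    transvectantCoeff 4 4 1 a b 6 =
      3 / 14 * (a 2 * b 5 - a 5 * b 2) + 5 / 14 * (a 3 * b 4 - a 4 * b 3) ∧
    transvectantCoeff 4 4 1 a b 7 = 1 / 2 * (a 3 * b 5 - a 5 * b 3) ∧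
    transvectantCoeff 4 4 1 a b 8 = a 4 * b 5 - a 5 * b 4 := by
  refine ⟨?_, ?_, ?_, ?_, ?_, ?_, ?_, ?_, ?_⟩ <;>
  · simp [transvectantCoeff, mulCoeff, Finset.sum_range_succ, Nat.choose]
    ring

/-- The normalized coefficients of the transvectant of index 3 of two binary quintics. -/
lemma transvectantCoeff_quintic_three (a b : ℕ → ℂ) :
    transvectantCoeff 2 2 3 a b 0 = (a 0 * b 3 - a 3 * b 0) - 3 * (a 1 * b 2 - a 2 * b 1) ∧
    transvectantCoeff 2 2 3 a b 1 = 1 / 2 * (a 0 * b 4 - a 4 * b 0) - (a 1 * b 3 - a 3 * b 1) ∧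
    transvectantCoeff 2 2 3 a b 2 =
      1 / 6 * (a 0 * b 5 - a 5 * b 0) + 1 / 6 * (a 1 * b 4 - a 4 * b 1) -
        4 / 3 * (a 2 * b 3 - a 3 * b 2) ∧
    transvectantCoeff 2 2 3 a b 3 = 1 / 2 * (a 1 * b 5 - a 5 * b 1) - (a 2 * b 4 - a 4 * b 2) ∧
    transvectantCoeff 2 2 3 a b 4 = (a 2 * b 5 - a 5 * b 2) - 3 * (a 3 * b 4 - a 4 * b 3) := by
  refine ⟨?_, ?_, ?_, ?_, ?_⟩ <;>
  · simp [transvectantCoeff, mulCoeff, Finset.sum_range_succ, Nat.choose]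
    ring

/-- The normalized coefficients of the transvectant of index 5 of two binary quintics. -/
lemma transvectantCoeff_quintic_five (a b : ℕ → ℂ) :
    transvectantCoeff 0 0 5 a b 0 =
      (a 0 * b 5 - a 5 * b 0) - 5 * (a 1 * b 4 - a 4 * b 1) + 10 * (a 2 * b 3 - a 3 * b 2) := by
  simp [transvectantCoeff, mulCoeff, Finset.sum_range_succ, Nat.choose]
  ring

set_option maxHeartbeats 4000000 in
/-- for binary quintics `A₁, A₂`, with `C₀ = (A₁,A₂)_1` (order 8) and
`C₂ = (-3/14) • (A₁,A₂)_3` (order 4), one has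
`C₀ * (A₁,A₂)_5 = 50 • C₂^2 - 15 • (C₀,C₀)_4 - 40 • (C₀,C₂)_2`. -/
theorem quintic_combinant_identity (A₁ A₂ C₀ C₂ : MvPolynomial (Fin 2) ℂ)
    (hA₁ : A₁.IsHomogeneous 5) (hA₂ : A₂.IsHomogeneous 5)
    (hC₀ : C₀ = transvectant 5 5 1 A₁ A₂)
    (hC₂ : C₂ = (-(3 : ℂ) / 14) • transvectant 5 5 3 A₁ A₂) :
    C₀ * transvectant 5 5 5 A₁ A₂ =
      (50 : ℂ) • C₂ ^ 2 - (15 : ℂ) • transvectant 8 8 4 C₀ C₀ -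
        (40 : ℂ) • transvectant 8 4 2 C₀ C₂ := by
  obtain ⟨a, rfl⟩ := hA₁.exists_eq_binaryForm
  obtain ⟨b, rfl⟩ := hA₂.exists_eq_binaryForm
  rw [hC₀, hC₂, transvectant_binaryForm_eq_binaryForm 0 0 5,
    transvectant_binaryForm_eq_binaryForm 4 4 1, transvectant_binaryForm_eq_binaryForm 2 2 3,
    ← binaryForm_smul, transvectant_binaryForm_eq_binaryForm 4 4 4,
    transvectant_binaryForm_eq_binaryForm 6 2 2, pow_two, binaryForm_mul, binaryForm_mul,
    sub_eq_add_neg, sub_eq_add_neg, ← neg_smul, ← neg_smul]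
  simp only [← binaryForm_smul, ← binaryForm_add]
  refine binaryForm_congr fun r hr => ?_
  obtain ⟨c0, c1, c2, c3, c4, c5, c6, c7, c8⟩ := transvectantCoeff_quintic_one a b
  obtain ⟨d0, d1, d2, d3, d4⟩ := transvectantCoeff_quintic_three a b
  have e0 := transvectantCoeff_quintic_five a b
  generalize transvectantCoeff 4 4 1 a b = c at *
  generalize transvectantCoeff 2 2 3 a b = d at *
  generalize transvectantCoeff 0 0 5 a b = e at *
  interval_cases r
  all_goals
    simp [transvectantCoeff, mulCoeff, Finset.sum_range_succ, Nat.choose]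
    simp only [c0, c1, c2, c3, c4, c5, c6, c7, c8, d0, d1, d2, d3, d4, e0]
    ring
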